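/- If G is a tree (a connected acyclic simple graph) with at least two vertices, then π(G) = [−1,1]; i.e., the matrix Q_q = (q^{∂(x,y)})_{x,y∈V} is positive semidefinite for every q ∈ [−1,1]. -/

import Mathlib

open scoped ComplexOrder

/-- `Q`-matrix positive semidefiniteness: the kernel `(x, y) ↦ q ^ ∂(x,y)` is a
positive definite kernel on the vertex set (with `0 ^ 0 = 1`). -/
def QPSD {V : Type*} (G : SimpleGraph V) (q : ℝ) : Prop :=
  ∀ f : V →₀ ℂ,
    0 ≤ ∑ x ∈ f.support, ∑ y ∈ f.support,
      (starRingEnd ℂ) (f x) * f y * (q : ℂ) ^ G.dist x y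

namespace TreeQ

variable {V : Type*}

lemma closer_unique {G : SimpleGraph V} (hG : G.IsTree) {r x a b : V}
    (ha : G.Adj x a) (hb : G.Adj x b) (hda : G.dist x r = G.dist a r + 1)
    (hdb : G.dist x r = G.dist b r + 1) : a = b := by
  obtain ⟨p, hp⟩ := hG.connected.exists_walk_length_eq_dist a r
  obtain ⟨s, hs⟩ := hG.connected.exists_walk_length_eq_dist b r
  have h1 : (SimpleGraph.Walk.cons ha p).IsPath :=
    SimpleGraph.Walk.isPath_of_length_eq_dist _ (by simp [hp, hda])
  have h2 : (SimpleGraph.Walk.cons hb s).IsPath :=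
    SimpleGraph.Walk.isPath_of_length_eq_dist _ (by simp [hs, hdb])
  have h3 := (hG.existsUnique_path x r).unique h1 h2
  have h4 := congrArg SimpleGraph.Walk.snd h3
  simpa using h4

lemma exists_closer {G : SimpleGraph V} (hG : G.IsTree) {x r : V} (hne : x ≠ r) :
    ∃ p, G.Adj x p ∧ G.dist x r = G.dist p r + 1 := by
  obtain ⟨w, hw⟩ := hG.connected.exists_walk_length_eq_dist x r
  cases w with
  | nil => exact absurd rfl hne
  | @cons _ p _ h w =>
    refine ⟨p, h, ?_⟩
    have h1 := SimpleGraph.dist_le w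
    simp only [SimpleGraph.Walk.length_cons] at hw
    have h2 := hG.dist_eq_dist_add_one_of_adj r h
    rw [SimpleGraph.dist_comm (u := r) (v := x), SimpleGraph.dist_comm (u := r) (v := p)] at h2
    omega

lemma dist_descend {G : SimpleGraph V} (hG : G.IsTree) (r y : V) :
    ∀ (n : ℕ) (p x : V), G.dist x y = n → G.Adj x p → G.dist x r = G.dist p r + 1 →
      G.dist p y = G.dist x y + 1 → G.dist y r = G.dist x r + n := by
  intro n
  induction n with
  | zero =>
    intro p x h0 _ _ _
    have : x = y := (hG.connected.dist_eq_zero_iff).1 h0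
    subst this; rfl
  | succ n ih =>
    intro p x hn hadj hr hy
    have hne : x ≠ y := by
      rintro rfl; simp at hn
    obtain ⟨x', hx', hd⟩ := exists_closer hG hne
    have hne' : x' ≠ p := by
      rintro rfl; omega
    have h2 := hG.dist_eq_dist_add_one_of_adj r hx'
    rw [SimpleGraph.dist_comm (u := r) (v := x), SimpleGraph.dist_comm (u := r) (v := x')] at h2
    rcases h2 with h2 | h2
    · exact absurd (closer_unique hG hx' hadj h2 hr) hne'
    · have := ih x x' (by omega) hx'.symm h2 hd
      omega

lemma dist_parent {G : SimpleGraph V} (hG : G.IsTree) {r x p y : V} (hadj : G.Adj x p)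
    (hr : G.dist x r = G.dist p r + 1) (hxy : x ≠ y) (hle : G.dist y r ≤ G.dist x r) :
    G.dist x y = G.dist p y + 1 := by
  have h2 := hG.dist_eq_dist_add_one_of_adj y hadj
  rw [SimpleGraph.dist_comm (u := y) (v := x), SimpleGraph.dist_comm (u := y) (v := p)] at h2
  rcases h2 with h2 | h2
  · exact h2
  · have h3 := dist_descend hG r y _ p x rfl hadj hr h2
    have := hG.connected.pos_dist_of_ne hxy
    omega

noncomputable def B (G : SimpleGraph V) (q : ℝ) (f g : V →₀ ℂ) : ℂ :=
  f.sum fun x a => g.sum fun y b => (starRingEnd ℂ) a * b * (q : ℂ) ^ G.dist x y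

lemma B_add_left (G : SimpleGraph V) (q : ℝ) (f f' g : V →₀ ℂ) :
    B G q (f + f') g = B G q f g + B G q f' g := by
  classical
  unfold B
  apply Finsupp.sum_add_index'
  · intro x; simp
  · intro x a b
    rw [← Finsupp.sum_add]
    refine Finsupp.sum_congr fun y _ => ?_
    rw [map_add]; ring

lemma B_add_right (G : SimpleGraph V) (q : ℝ) (f g g' : V →₀ ℂ) :
    B G q f (g + g') = B G q f g + B G q f g' := by
  classical
  unfold B
  rw [← Finsupp.sum_add]
  refine Finsupp.sum_congr fun x _ => ?_
  apply Finsupp.sum_add_index'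
  · intro y; simp
  · intro y a b; ring

lemma B_single_right (G : SimpleGraph V) (q : ℝ) (f : V →₀ ℂ) (y : V) (b : ℂ) :
    B G q f (Finsupp.single y b) =
      f.sum fun x a => (starRingEnd ℂ) a * b * (q : ℂ) ^ G.dist x y := by
  unfold B
  refine Finsupp.sum_congr fun x _ => ?_
  rw [Finsupp.sum_single_index (by simp)]

lemma B_single_left (G : SimpleGraph V) (q : ℝ) (g : V →₀ ℂ) (x : V) (a : ℂ) :
    B G q (Finsupp.single x a) g =
      g.sum fun y b => (starRingEnd ℂ) a * b * (q : ℂ) ^ G.dist x y := by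
  unfold B
  rw [Finsupp.sum_single_index (by simp)]

lemma B_single (G : SimpleGraph V) (q : ℝ) (x y : V) (a b : ℂ) :
    B G q (Finsupp.single x a) (Finsupp.single y b) =
      (starRingEnd ℂ) a * b * (q : ℂ) ^ G.dist x y := by
  rw [B_single_left, Finsupp.sum_single_index (by simp)]

lemma B_nonneg {G : SimpleGraph V} (hG : G.IsTree) (r : V) {q : ℝ} (hq : q ^ 2 ≤ 1) :
    ∀ (n : ℕ) (f : V →₀ ℂ), ∑ x ∈ f.support, G.dist x r = n → 0 ≤ B G q f f := by
  classical
  intro n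
  induction n using Nat.strong_induction_on with
  | _ n ih =>
  intro f hf
  rcases f.support.eq_empty_or_nonempty with h0 | hne
  · rw [Finsupp.support_eq_empty] at h0
    subst h0; simp [B]
  obtain ⟨x, hx, hmax⟩ := Finset.exists_max_image f.support (fun x => G.dist x r) hne
  have hconj : ∀ a : ℂ, (starRingEnd ℂ) a * a = ((Complex.normSq a : ℝ) : ℂ) := fun a => by
    rw [Complex.normSq_eq_conj_mul_self]
  by_cases hxr : x = r
  · subst hxr
    have hs : f = Finsupp.single x (f x) := by
      apply Finsupp.support_subset_singleton.1
      intro y hy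
      have h1 := hmax y hy
      simp only [SimpleGraph.dist_self, Nat.le_zero] at h1
      simpa using (hG.connected.dist_eq_zero_iff).1 h1
    rw [hs, B_single, SimpleGraph.dist_self, pow_zero, mul_one, hconj]
    exact_mod_cast Complex.normSq_nonneg _
  · obtain ⟨p, hadj, hd⟩ := exists_closer hG hxr
    set a := f x with ha
    set g := f.erase x with hg
    have hfg : f = g + Finsupp.single x a := (Finsupp.erase_add_single x f).symm
    have hgs : g.support = f.support.erase x := Finsupp.support_erase
    set f' := g + Finsupp.single p ((q : ℂ) * a) with hf'
    have hdist : ∀ y ∈ g.support, G.dist x y = G.dist p y + 1 := by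
      intro y hy
      rw [hgs, Finset.mem_erase] at hy
      exact dist_parent hG hadj hd (Ne.symm hy.1) (hmax y hy.2)
    have hsub : f'.support ⊆ insert p (f.support.erase x) := by
      refine Finsupp.support_add.trans ?_
      rw [hgs]
      intro y hy
      rcases Finset.mem_union.1 hy with h | h
      · exact Finset.mem_insert_of_mem h
      · have := Finsupp.support_single_subset h
        simp at this
        simp [this]
    have hlt : ∑ y ∈ f'.support, G.dist y r < n := by
      have h1 : ∑ y ∈ f'.support, G.dist y r ≤ ∑ y ∈ insert p (f.support.erase x), G.dist y r :=
        Finset.sum_le_sum_of_subset hsub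
      have h2 : ∑ y ∈ insert p (f.support.erase x), G.dist y r
          ≤ G.dist p r + ∑ y ∈ f.support.erase x, G.dist y r := by
        by_cases hp : p ∈ f.support.erase x
        · rw [Finset.insert_eq_of_mem hp]; omega
        · rw [Finset.sum_insert hp]
      have h3 := Finset.add_sum_erase f.support (fun y => G.dist y r) hx
      omega
    have hpos := ih _ hlt f' rfl
    have e1 : B G q g (Finsupp.single x a) = B G q g (Finsupp.single p ((q : ℂ) * a)) := by
      rw [B_single_right, B_single_right]
      refine Finsupp.sum_congr fun y hy => ?_
      rw [SimpleGraph.dist_comm, hdist y hy, SimpleGraph.dist_comm (u := y)]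
      ring
    have e2 : B G q (Finsupp.single x a) g = B G q (Finsupp.single p ((q : ℂ) * a)) g := by
      rw [B_single_left, B_single_left]
      refine Finsupp.sum_congr fun y hy => ?_
      rw [hdist y hy, map_mul, Complex.conj_ofReal]
      ring
    have key : B G q f f = B G q f' f' + ((Complex.normSq a * (1 - q ^ 2) : ℝ) : ℂ) := by
      rw [hfg, hf']
      simp only [B_add_left, B_add_right, e1, e2, B_single, SimpleGraph.dist_self, map_mul,
        Complex.conj_ofReal]
      push_cast
      rw [← hconj]
      ring
    rw [key]
    refine add_nonneg hpos ?_
    exact_mod_cast mul_nonneg (Complex.normSq_nonneg _) (by linarith)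

end TreeQ

open TreeQ

theorem stmt17 {V : Type*} (G : SimpleGraph V) (htree : G.IsTree)
    (hV : ∃ x y : V, x ≠ y) :
    {q : ℝ | QPSD G q} = Set.Icc (-1 : ℝ) 1 := by
  obtain ⟨r, r', hne⟩ := hV
  ext q
  simp only [Set.mem_ofPred_eq, Set.mem_Icc]
  constructor
  · intro h
    have h' : ∀ f : V →₀ ℂ, 0 ≤ B G q f f := h
    obtain ⟨p, hadj, -⟩ := exists_closer htree hne
    have hd := SimpleGraph.dist_eq_one_iff_adj.2 hadj
    have hd' := SimpleGraph.dist_eq_one_iff_adj.2 hadj.symm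
    have h1 := h' (Finsupp.single r 1 + Finsupp.single p 1)
    have h2 := h' (Finsupp.single r 1 + Finsupp.single p (-1))
    simp only [B_add_left, B_add_right, B_single, hd, hd', SimpleGraph.dist_self, map_one,
      map_neg] at h1 h2
    have h3 := (Complex.le_def.1 h1).1
    have h4 := (Complex.le_def.1 h2).1
    simp at h3 h4
    constructor <;> linarith
  · rintro ⟨h1, h2⟩ f
    exact B_nonneg htree r (by nlinarith) _ f rfl
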